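/- Let f ⊆ {0,…,d} with 1 ≤ |f| ≤ d−1, let p ∈ f, and let i, j ∈ f* := {0,…,d}\f with i ≠ j. For k ∈ {0,…,d} define b^{(k)} : R^d → R by b^{(k)}(x) := Π_{s∈f} μ^{(k)}_s(x), and define B_k : R^d → 𝕊 by B_i(x) := b^{(i)}(x)·sym(t_{p,c} ⊗ t_{p,j}), B_j(x) := −b^{(j)}(x)·sym(t_{p,c} ⊗ t_{p,i}), and B_k := 0 for k ∉ {i,j} (so B_k is the restriction to the cell T_k of the field b^R_f·φ^f_{ij}). Then for every 0 ≤ k < ℓ ≤ d, every x ∈ F_{kℓ}, and every vector n orthogonal to v_m − v_c for all m ∈ {0,…,d}\{k,ℓ}, one has (B_k(x) − B_ℓ(x))·n = 0. (Hence b^R_f·φ^f_{ij} ∈ H(div,T;𝕊) ∩ P^{-1}_{|f|}(T^R;𝕊): the enriched bubble field has vanishing normal jumps across all interior faces of the barycentric split.) -/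

import Mathlib

open Matrix Finset

/-- `sym(a ⊗ b) = (a bᵀ + b aᵀ)/2`, the symmetric part of the rank-one matrix `a bᵀ`. -/
noncomputable def symOuter {d : ℕ} (a b : Fin d → ℝ) : Matrix (Fin d) (Fin d) ℝ :=
  (1 / 2 : ℝ) • (Matrix.vecMulVec a b + Matrix.vecMulVec b a)

theorem symOuter_mulVec {d : ℕ} (a b n : Fin d → ℝ) :
    symOuter a b *ᵥ n = (1 / 2 : ℝ) • ((b ⬝ᵥ n) • a + (a ⬝ᵥ n) • b) := by
  simp [symOuter, Matrix.smul_mulVec, Matrix.add_mulVec, Matrix.vecMulVec_mulVec]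

/-- Two functions that are affine and agree on a set agree on its convex hull. -/
theorem eq_on_convexHull_of_affine {E : Type*} [AddCommGroup E] [Module ℝ E] {g h : E → ℝ}
    (hg : ∃ q : E →ᵃ[ℝ] ℝ, ∀ x, g x = q x) (hh : ∃ q : E →ᵃ[ℝ] ℝ, ∀ x, h x = q x)
    {s : Set E} (hs : ∀ x ∈ s, g x = h x) {x : E} (hx : x ∈ convexHull ℝ s) : g x = h x := by
  obtain ⟨q, hq⟩ := hg
  obtain ⟨r, hr⟩ := hh
  have hconv : Convex ℝ ((q - r) ⁻¹' {0}) := (convex_singleton (0 : ℝ)).affine_preimage (q - r)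
  have hsub : s ⊆ (q - r) ⁻¹' {0} := fun y hy => by
    simp [← hq, ← hr, hs y hy]
  have := convexHull_min hsub hconv hx
  simpa [← hq, ← hr, sub_eq_zero] using this

/-- If `n` is orthogonal to `v m - c` for all `m` except `k` and `l`, where `c` is the barycenter
of the `v m`, then `n` is orthogonal to `(v k - c) + (v l - c)`. -/
theorem dotProduct_add_eq_zero_of_barycenter {d : ℕ} (v : Fin (d + 1) → (Fin d → ℝ))
    {c : Fin d → ℝ} (hc : c = ((d : ℝ) + 1)⁻¹ • ∑ k, v k) {k l : Fin (d + 1)} (hkl : k ≠ l)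
    {n : Fin d → ℝ} (hn : ∀ m, m ≠ k → m ≠ l → (v m - c) ⬝ᵥ n = 0) :
    (v k - c) ⬝ᵥ n + (v l - c) ⬝ᵥ n = 0 := by
  have hd : (d : ℝ) + 1 ≠ 0 := by positivity
  have hsum : ∑ m, (v m - c) = 0 := by
    have : ((d : ℝ) + 1) • c = ∑ k, v k := by rw [hc, smul_inv_smul₀ hd]
    rw [Finset.sum_sub_distrib, ← this]
    simp only [Finset.sum_const, Finset.card_univ, Fintype.card_fin]
    rw [← Nat.cast_smul_eq_nsmul ℝ]
    push_cast
    exact sub_self _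
  have hdot : ∑ m, (v m - c) ⬝ᵥ n = 0 := by
    rw [← sum_dotProduct, hsum, zero_dotProduct]
  rw [← Finset.sum_pair hkl (f := fun m => (v m - c) ⬝ᵥ n), ← hdot]
  refine Finset.sum_subset (Finset.subset_univ _) fun m _ hm => ?_
  simp only [Finset.mem_insert, Finset.mem_singleton, not_or] at hm
  exact hn m hm.1 hm.2

/-- The enriched bubble field `b^R_f φ^f_{ij}` — equal to
`b^{(i)}(x) sym(t_{p,c} ⊗ t_{p,j})` on `T_i`, `-b^{(j)}(x) sym(t_{p,c} ⊗ t_{p,i})` on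
`T_j`, and `0` on the other cells, where `b^{(k)}(x) = ∏_{s∈f} μ^{(k)}_s(x)` — has
vanishing normal jumps across all interior faces `F_{kℓ}` of the barycentric split, i.e.
`b^R_f φ^f_{ij} ∈ H(div,T;𝕊) ∩ P⁻¹_{|f|}(T^R;𝕊)`. -/
theorem statement11 (d : ℕ) (hd : 2 ≤ d)
    (v : Fin (d + 1) → (Fin d → ℝ)) (hv : AffineIndependent ℝ v)
    (vc : Fin d → ℝ) (hvc : vc = ((d : ℝ) + 1)⁻¹ • ∑ k, v k)
    -- barycentric coordinates of the affine bases {v m : m ≠ k} ∪ {v_c}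
    (μ : Fin (d + 1) → Fin (d + 1) → (Fin d → ℝ) → ℝ)
    (μc : Fin (d + 1) → (Fin d → ℝ) → ℝ)
    (hμaff : ∀ k m, ∃ q : (Fin d → ℝ) →ᵃ[ℝ] ℝ, ∀ x, μ k m x = q x)
    (hμcaff : ∀ k, ∃ q : (Fin d → ℝ) →ᵃ[ℝ] ℝ, ∀ x, μc k x = q x)
    (hμself : ∀ k x, μ k k x = 0)
    (hμsum : ∀ k x, μc k x + ∑ m, μ k m x = 1)
    (hμval : ∀ k m m' : Fin (d + 1), m ≠ k → m' ≠ k →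
      μ k m (v m') = if m = m' then 1 else 0)
    (hμvc : ∀ k m : Fin (d + 1), m ≠ k → μ k m vc = 0)
    (hμcval : ∀ k m' : Fin (d + 1), m' ≠ k → μc k (v m') = 0)
    (hμcvc : ∀ k, μc k vc = 1)
    -- the subsimplex f, a vertex p ∈ f and two indices i ≠ j in f*
    (f : Finset (Fin (d + 1))) (hf1 : 1 ≤ f.card) (hf2 : f.card ≤ d - 1)
    (p : Fin (d + 1)) (hp : p ∈ f)
    (i j : Fin (d + 1)) (hi : i ∉ f) (hj : j ∉ f) (hij : i ≠ j)
    -- the field b^R_f φ^f_{ij}, cell by cell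
    (B : Fin (d + 1) → (Fin d → ℝ) → Matrix (Fin d) (Fin d) ℝ)
    (hBi : ∀ x, B i x = (∏ s ∈ f, μ i s x) • symOuter (vc - v p) (v j - v p))
    (hBj : ∀ x, B j x = -((∏ s ∈ f, μ j s x) • symOuter (vc - v p) (v i - v p)))
    (hBother : ∀ k : Fin (d + 1), k ≠ i → k ≠ j → B k = 0) :
    ∀ k ℓ : Fin (d + 1), k < ℓ →
      ∀ x ∈ convexHull ℝ ((v '' {m | m ≠ k ∧ m ≠ ℓ}) ∪ {vc}),
        ∀ n : Fin d → ℝ,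
          (∀ m : Fin (d + 1), m ≠ k → m ≠ ℓ → (v m - vc) ⬝ᵥ n = 0) →
          (B k x - B ℓ x) *ᵥ n = 0 := by
  have hzero : ∀ k l : Fin (d + 1), l ≠ k →
      ∀ x ∈ convexHull ℝ ((v '' {m | m ≠ k ∧ m ≠ l}) ∪ {vc}), μ k l x = 0 := by
    intro k l hlk x hx
    refine eq_on_convexHull_of_affine (h := fun _ => 0) (hμaff k l)
      ⟨AffineMap.const ℝ _ 0, fun _ => rfl⟩ ?_ hx
    rintro _ (⟨m, ⟨hmk, hml⟩, rfl⟩ | rfl)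
    · rw [hμval k l m hlk hmk, if_neg (Ne.symm hml)]
    · exact hμvc k l hlk
  have hagree : ∀ k l m : Fin (d + 1), m ≠ k → m ≠ l →
      ∀ x ∈ convexHull ℝ ((v '' {m | m ≠ k ∧ m ≠ l}) ∪ {vc}), μ k m x = μ l m x := by
    intro k l m hmk hml x hx
    refine eq_on_convexHull_of_affine (hμaff k m) (hμaff l m) ?_ hx
    rintro _ (⟨m', ⟨hk, hl⟩, rfl⟩ | rfl)
    · rw [hμval k m m' hmk hk, hμval l m m' hml hl]
    · rw [hμvc k m hmk, hμvc l m hml]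
  have hpi : p ≠ i := fun h => hi (h ▸ hp)
  have hpj : p ≠ j := fun h => hj (h ▸ hp)
  have hdiff : ∀ (a b n : Fin d → ℝ), (a - b) ⬝ᵥ n = (a - vc) ⬝ᵥ n - (b - vc) ⬝ᵥ n := by
    intro a b n
    rw [← sub_dotProduct, sub_sub_sub_cancel_right]
  have hbubble : ∀ q r : Fin (d + 1), q ∉ f → r ≠ q → p ≠ q → ∀ l, l ≠ q → l ≠ r →
      ∀ x ∈ convexHull ℝ ((v '' {m | m ≠ q ∧ m ≠ l}) ∪ {vc}), ∀ n : Fin d → ℝ,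
        (∀ m, m ≠ q → m ≠ l → (v m - vc) ⬝ᵥ n = 0) →
        ((∏ s ∈ f, μ q s x) • symOuter (vc - v p) (v r - v p)) *ᵥ n = 0 := by
    intro q r hq hrq hpq l hlq hlr x hx n hn
    by_cases hl : l ∈ f
    · rw [Finset.prod_eq_zero hl (hzero q l hlq x hx), zero_smul, zero_mulVec]
    · have hpl : p ≠ l := fun h => hl (h ▸ hp)
      rw [Matrix.smul_mulVec, symOuter_mulVec, hdiff (v r), hdiff vc, hn p hpq hpl,
        hn r hrq hlr.symm]
      simp
  let P : Fin (d + 1) → Fin (d + 1) → Prop := fun k l =>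
    ∀ x ∈ convexHull ℝ ((v '' {m | m ≠ k ∧ m ≠ l}) ∪ {vc}), ∀ n : Fin d → ℝ,
      (∀ m, m ≠ k → m ≠ l → (v m - vc) ⬝ᵥ n = 0) → (B k x - B l x) *ᵥ n = 0
  have hsymm : ∀ k l, P l k → P k l := by
    intro k l h x hx n hn
    simp only [and_comm (a := _ ≠ k)] at hx
    rw [← neg_sub, Matrix.neg_mulVec, h x hx n fun m hl hk => hn m hk hl, neg_zero]
  have hPi : ∀ l, l ≠ i → P i l := by
    intro l hli x hx n hn
    by_cases hlj : l = j
    · subst hlj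
      have hprod : ∏ s ∈ f, μ i s x = ∏ s ∈ f, μ l s x :=
        Finset.prod_congr rfl fun s hs => hagree i l s (fun h => hi (h ▸ hs))
          (fun h => hj (h ▸ hs)) x hx
      have hsum := dotProduct_add_eq_zero_of_barycenter v hvc hij hn
      rw [hBi, hBj, hprod, sub_neg_eq_add, ← smul_add, Matrix.smul_mulVec, Matrix.add_mulVec,
        symOuter_mulVec, symOuter_mulVec, hdiff (v i), hdiff (v l), hdiff vc, hn p hpi hpj,
        eq_neg_of_add_eq_zero_left hsum]
      simp only [sub_self, zero_dotProduct, sub_zero, zero_smul, add_zero, neg_smul, smul_neg,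
        add_neg_cancel, smul_zero]
    · rw [hBother l hli hlj, Pi.zero_apply, sub_zero, hBi]
      exact hbubble i j hi hij.symm hpi l hli hlj x hx n hn
  have hPj : ∀ l, l ≠ i → l ≠ j → P j l := by
    intro l hli hlj x hx n hn
    rw [hBother l hli hlj, Pi.zero_apply, sub_zero, hBj, Matrix.neg_mulVec,
      hbubble j i hj hij hpj l hlj hli x hx n hn, neg_zero]
  intro k l hkl
  change P k l
  by_cases hki : k = i
  · exact hki ▸ hPi l (hki ▸ hkl.ne')
  by_cases hli : l = i
  · exact hsymm k l (hli ▸ hPi k hki)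
  by_cases hkj : k = j
  · exact hkj ▸ hPj l hli (hkj ▸ hkl.ne')
  by_cases hlj : l = j
  · exact hsymm k l (hlj ▸ hPj k hki hkj)
  intro x _ n _
  rw [hBother k hki hkj, hBother l hli hlj, sub_self, zero_mulVec]
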